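/- Let L ≥ 1 be an integer, let η ≥ 0, and let g, g̃ ∈ ℝ^L be vectors with |g_k| ≤ 1 and |g̃_k| ≤ 1 for all 1 ≤ k ≤ L, such that |exp(g_k) − exp(g̃_k)| ≤ η for every 1 ≤ k ≤ L. Then for every 1 ≤ t ≤ L, |softmax(g)_t − softmax(g̃)_t| ≤ e² (2e·η + η²) / L, where softmax(g)_t = exp(g_t) / Σ_{k=1}^{L} exp(g_k). -/

import Mathlib

open Matrix

noncomputable section


/-- Normalizing two vectors with entries in `[m, M]` that are entrywise `η`-close gives
vectors whose entries differ by at most `2Mη / (m² n)`, where `n` is the dimension. -/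
theorem abs_div_sum_sub_div_sum_le {ι : Type*} [Fintype ι] [Nonempty ι] {m M η : ℝ}
    (hm : 0 < m) {a b : ι → ℝ} (ha : ∀ k, m ≤ a k) (hb : ∀ k, m ≤ b k) (haM : ∀ k, a k ≤ M)
    (hab : ∀ k, |a k - b k| ≤ η) (t : ι) :
    |a t / (∑ k, a k) - b t / (∑ k, b k)| ≤ 2 * M * η / (m ^ 2 * Fintype.card ι) := by
  have hn : (0 : ℝ) < Fintype.card ι := by exact_mod_cast Fintype.card_pos
  have le_sum {c : ι → ℝ} (hc : ∀ k, m ≤ c k) : Fintype.card ι * m ≤ ∑ k, c k := by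
    simpa using Finset.card_nsmul_le_sum Finset.univ c m fun k _ => hc k
  have hA := le_sum ha
  have hB := le_sum hb
  have hA0 : 0 < ∑ k, a k := (mul_pos hn hm).trans_le hA
  have hB0 : 0 < ∑ k, b k := (mul_pos hn hm).trans_le hB
  have hη : 0 ≤ η := (abs_nonneg _).trans (hab t)
  have hM : 0 ≤ M := hm.le.trans ((ha t).trans (haM t))
  have abs_a_le (k : ι) : |a k| ≤ M := by
    rw [abs_of_pos (hm.trans_le (ha k))]
    exact haM k
  have hterm (k : ι) : |a t * b k - b t * a k| ≤ 2 * M * η := by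
    calc |a t * b k - b t * a k|
        = |a k * (a t - b t) - a t * (a k - b k)| := by ring_nf
      _ ≤ |a k| * |a t - b t| + |a t| * |a k - b k| := by
        simpa only [abs_mul] using abs_sub (a k * (a t - b t)) (a t * (a k - b k))
      _ ≤ M * η + M * η := by gcongr <;> first | exact abs_a_le _ | exact hab _
      _ = 2 * M * η := by ring
  have hnum : |a t * (∑ k, b k) - (∑ k, a k) * b t| ≤ Fintype.card ι * (2 * M * η) := by
    calc |a t * (∑ k, b k) - (∑ k, a k) * b t|
        = |∑ k, (a t * b k - b t * a k)| := by
          rw [Finset.sum_sub_distrib, ← Finset.mul_sum, ← Finset.mul_sum, mul_comm (b t)]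
      _ ≤ ∑ k, |a t * b k - b t * a k| := Finset.abs_sum_le_sum_abs _ _
      _ ≤ Fintype.card ι * (2 * M * η) := by
        simpa using Finset.sum_le_card_nsmul Finset.univ _ _ fun k _ => hterm k
  rw [div_sub_div _ _ hA0.ne' hB0.ne', abs_div, abs_of_pos (mul_pos hA0 hB0)]
  calc |a t * (∑ k, b k) - (∑ k, a k) * b t| / ((∑ k, a k) * ∑ k, b k)
      ≤ Fintype.card ι * (2 * M * η) / ((Fintype.card ι * m) * (Fintype.card ι * m)) := by gcongr
    _ = 2 * M * η / (m ^ 2 * Fintype.card ι) := by field_simp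

/-- Softmax perturbation bound: if `|gₖ|, |g̃ₖ| ≤ 1` and
`|exp(gₖ) - exp(g̃ₖ)| ≤ η` for all `k`, then
`|softmax(g)ₜ - softmax(g̃)ₜ| ≤ e²(2eη + η²)/L`. -/
theorem softmax_perturbation
    (L : ℕ) (hL : 1 ≤ L) (η : ℝ) (hη : 0 ≤ η)
    (g g' : Fin L → ℝ)
    (hg : ∀ k, |g k| ≤ 1) (hg' : ∀ k, |g' k| ≤ 1)
    (hclose : ∀ k, |Real.exp (g k) - Real.exp (g' k)| ≤ η) :
    ∀ t : Fin L,
      |Real.exp (g t) / (∑ k, Real.exp (g k))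
        - Real.exp (g' t) / (∑ k, Real.exp (g' k))|
        ≤ Real.exp 2 * (2 * Real.exp 1 * η + η ^ 2) / L := by
  intro t
  have : Nonempty (Fin L) := ⟨t⟩
  calc |Real.exp (g t) / (∑ k, Real.exp (g k)) - Real.exp (g' t) / (∑ k, Real.exp (g' k))|
      ≤ 2 * Real.exp 1 * η / (Real.exp (-1) ^ 2 * Fintype.card (Fin L)) :=
        abs_div_sum_sub_div_sum_le (Real.exp_pos _)
          (fun k => Real.exp_le_exp.2 (abs_le.1 (hg k)).1)
          (fun k => Real.exp_le_exp.2 (abs_le.1 (hg' k)).1)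
          (fun k => Real.exp_le_exp.2 (abs_le.1 (hg k)).2) hclose t
    _ = Real.exp 2 * (2 * Real.exp 1 * η) / L := by
        have h : Real.exp (-1) ^ 2 = (Real.exp 2)⁻¹ := by
          rw [← Real.exp_neg, ← Real.exp_nat_mul]
          norm_num
        rw [h, Fintype.card_fin]
        field_simp
    _ ≤ Real.exp 2 * (2 * Real.exp 1 * η + η ^ 2) / L := by
        gcongr
        exact le_add_of_nonneg_right (sq_nonneg η)

end
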